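/- arXiv:2512.10190 — 3 statements merged into one kernel-verified Lean document; each statement's English description precedes it below -/
import Mathlib

section
/- Let r ≥ 2 be an integer. Suppose G is an n-vertex K_{r+1}-free simple graph satisfying (3r-2)·δ(G) + Δ(G) > (3r-4)·n (equivalently, δ(G) > ((3r-4)/(3r-2))·n − Δ(G)/(3r-2)). Then G is r-partite. -/
namespace SimpleGraph

open Finset

variable {V : Type*} {G : SimpleGraph V}

lemma CliqueFree.induce_neighborSet {n : ℕ} (h : G.CliqueFree (n + 1)) (u : V) :
    (G.induce (G.neighborSet u)).CliqueFree n := by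
  classical
  intro s hs
  have hs' := (hs.map (f := Function.Embedding.subtype _)).mono
    (map_comap_le (Function.Embedding.subtype _) G)
  refine h _ (hs'.insert (a := u) ?_)
  simp +contextual

/-- If the non-neighbours of `u` are independent, a colouring of its neighbourhood extends to the
whole graph at the cost of one colour. -/
lemma Colorable.of_induce_neighborSet {n : ℕ} {u : V}
    (h : (G.induce (G.neighborSet u)).Colorable n)
    (hind : ∀ ⦃a b⦄, ¬ G.Adj u a → ¬ G.Adj u b → ¬ G.Adj a b) : G.Colorable (n + 1) := by
  classical
  obtain ⟨C⟩ := h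
  let D : G.Coloring (Option (Fin n)) := Coloring.mk
    (fun x ↦ if hx : G.Adj u x then some (C ⟨x, hx⟩) else none) (by
      intro a b hab
      by_cases ha : G.Adj u a <;> by_cases hb : G.Adj u b
      · simpa [ha, hb] using
          C.valid (v := ⟨a, ha⟩) (w := ⟨b, hb⟩) (by simpa using hab)
      · simp [ha, hb]
      · simp [ha, hb]
      · exact (hind ha hb hab).elim)
  simpa using D.colorable

variable [Fintype V]

lemma degree_add_card_le_degree_induce_add_card [DecidableRel G.Adj] (s : Set V)
    [Fintype s] [DecidableRel (G.induce s).Adj] (x : s) :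
    G.degree x + Fintype.card s ≤ (G.induce s).degree x + Fintype.card V := by
  classical
  have hsub : G.neighborFinset x ⊆
      ((G.induce s).neighborFinset x).map (Function.Embedding.subtype _) ∪ s.toFinsetᶜ := by
    intro y hy
    by_cases hys : y ∈ s <;> simp_all
  have h1 := (card_le_card hsub).trans (card_union_le _ _)
  rw [card_map, card_neighborFinset_eq_degree, card_neighborFinset_eq_degree] at h1
  have h2 := card_add_card_compl s.toFinset
  rw [Set.toFinset_card] at h2
  lia

/-- In a `K_{r+2}`-free graph, a wheel-like structure which cannot be enlarged with the same `v`, `w₁`, `w₂`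
bounds a weighted sum of the minimum degree and the degree of `v`. -/
lemma IsFiveWheelLike.minDegree_mul_add_degree_le [DecidableEq V] [DecidableRel G.Adj]
    {r k : ℕ} {v w₁ w₂ : V} {s t : Finset V} (hw : G.IsFiveWheelLike r k v w₁ w₂ s t)
    (hcf : G.CliqueFree (r + 2))
    (hm : ∀ s' t', ¬ G.IsFiveWheelLike r (k + 1) v w₁ w₂ s' t') :
    (2 * r + k + 2) * G.minDegree + G.degree v ≤ (2 * r + k) * Fintype.card V := by
  set W := {v} ∪ ({w₁} ∪ ({w₂} ∪ (s ∪ t))) with hW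
  have Wc : #W + k = 2 * r + 3 := by grind
  have hkc := hw.card_inter
  have hvW : v ∈ W := by simp [W]
  have pointwise (x : V) : #{z ∈ W | G.Adj x z} + 2 * #{z ∈ s ∩ t | G.Adj x z} ≤ 2 * r + k := by
    have hW' := card_filter_add_card_filter_not (s := W) (G.Adj x)
    have hst' := card_filter_add_card_filter_not (s := s ∩ t) (G.Adj x)
    by_cases hx : ∀ ⦃y⦄, y ∈ s ∩ t → G.Adj x y
    · have : ¬ #{z ∈ W | ¬ G.Adj x z} ≤ 2 := fun h ↦
        let ⟨_, _, h'⟩ := hw.exists_isFiveWheelLike_succ_of_not_adj_le_two hcf hx h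
        hm _ _ h'
      lia
    · push Not at hx
      obtain ⟨y, hy, hxy⟩ := hx
      have h1 : 0 < #{z ∈ s ∩ t | ¬ G.Adj x z} := card_pos.2 ⟨y, mem_filter.2 ⟨hy, hxy⟩⟩
      have h2 : 0 < #{z ∈ W | ¬ G.Adj x z} :=
        card_pos.2 ⟨y, mem_filter.2 ⟨by grind, hxy⟩⟩
      lia
  have double (A : Finset V) : ∑ w ∈ A, G.degree w = ∑ x, #{z ∈ A | G.Adj x z} := by
    simp_rw [← card_neighborFinset_eq_degree, neighborFinset_eq_filter]
    simpa [bipartiteAbove, bipartiteBelow, adj_comm] using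
      sum_card_bipartiteAbove_eq_sum_card_bipartiteBelow (s := A) (t := univ) G.Adj
  have upper : ∑ w ∈ W, G.degree w + 2 * ∑ w ∈ s ∩ t, G.degree w ≤
      (2 * r + k) * Fintype.card V := by
    rw [double, double, mul_sum, ← sum_add_distrib]
    refine (sum_le_card_nsmul univ _ _ fun x _ ↦ pointwise x).trans ?_
    simp [mul_comm]
  have lowerW : G.degree v + #(W.erase v) * G.minDegree ≤ ∑ w ∈ W, G.degree w := by
    rw [← add_sum_erase _ _ hvW]
    gcongr
    simpa using card_nsmul_le_sum (W.erase v) _ _ fun w _ ↦ G.minDegree_le_degree w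
  have lowerC : k * G.minDegree ≤ ∑ w ∈ s ∩ t, G.degree w := by
    simpa [hkc] using card_nsmul_le_sum (s ∩ t) _ _ fun w _ ↦ G.minDegree_le_degree w
  have hc : 2 * r + k + 2 = #(W.erase v) + 2 * k := by
    have := card_erase_add_one hvW
    lia
  rw [hc]
  linarith

/-- In a maximal `K_{r+2}`-free graph, a vertex `v` with
adjacent non-neighbours has small degree compared with the minimum degree. -/
lemma IsPathGraph3Compl.minDegree_mul_add_degree_le [DecidableRel G.Adj] {r : ℕ} {v w₁ w₂ : V}
    (hp : G.IsPathGraph3Compl v w₁ w₂) (hmax : Maximal (fun H ↦ H.CliqueFree (r + 2)) G) :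
    (3 * r + 1) * G.minDegree + G.degree v + Fintype.card V ≤ 3 * r * Fintype.card V := by
  classical
  obtain ⟨s, h1, h2, h3, h4⟩ := exists_of_maximal_cliqueFree_not_adj hmax hp.ne_fst hp.not_adj_fst
  obtain ⟨t, h5, h6, h7, h8⟩ := exists_of_maximal_cliqueFree_not_adj hmax hp.ne_snd hp.not_adj_snd
  let P : ℕ → Prop := fun k ↦ ∃ s t, G.IsFiveWheelLike r k v w₁ w₂ s t
  have hw : G.IsFiveWheelLike r #(s ∩ t) v w₁ w₂ s t := ⟨hp, h1, h5, h2, h6, h3, h4, h7, h8, rfl⟩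
  obtain ⟨s', t', hw'⟩ : P (Nat.findGreatest P r) :=
    Nat.findGreatest_spec (hw.card_inter_lt_of_cliqueFree hmax.1).le ⟨s, t, hw⟩
  have hlt := hw'.card_inter_lt_of_cliqueFree hmax.1
  have hbound := hw'.minDegree_mul_add_degree_le hmax.1 fun s'' t'' h ↦
    (Nat.lt_succ_self _).not_ge <|
      Nat.le_findGreatest (h.card_inter_lt_of_cliqueFree hmax.1).le (⟨s'', t'', h⟩ : P _)
  obtain ⟨j, hj⟩ := Nat.exists_eq_add_of_lt hlt
  have hδ : G.minDegree ≤ Fintype.card V :=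
    (G.minDegree_le_degree v).trans (G.degree_lt_card_verts v).le
  generalize Nat.findGreatest P r = k at *
  subst hj
  have := Nat.mul_le_mul_left j hδ
  linarith

lemma colorable_induce_neighborSet [DecidableRel G.Adj] {r : ℕ} {u : V}
    (hfree : G.CliqueFree (r + 2)) (hu : 0 < G.degree u)
    (hdeg : 3 * r * Fintype.card V <
      (3 * r + 1) * G.minDegree + G.degree u + Fintype.card V)
    (hδ : G.minDegree ≤ G.degree u) :
    (G.induce (G.neighborSet u)).Colorable r := by
  classical
  have hfree' := hfree.induce_neighborSet u
  have hne : Nonempty (G.neighborSet u) := by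
    rwa [← Fintype.card_pos_iff, card_neighborSet_eq_degree]
  match r with
  | 0 =>
    exact ((cliqueFree_one.1 hfree').false hne.some).elim
  | 1 =>
    rw [cliqueFree_two.1 hfree']
    exact ⟨Coloring.mk (fun _ ↦ 0) (by simp)⟩
  | r + 2 =>
    refine colorable_of_cliqueFree_lt_minDegree hfree' ?_
    obtain ⟨x, hx⟩ := (G.induce (G.neighborSet u)).exists_minimal_degree_vertex
    have hx' := degree_add_card_le_degree_induce_add_card (G := G) (G.neighborSet u) x
    have hxδ := G.minDegree_le_degree x
    rw [← hx, card_neighborSet_eq_degree] at hx'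
    rw [card_neighborSet_eq_degree, Nat.div_lt_iff_lt_mul (by lia),
      show 3 * (r + 2) - 4 = 3 * r + 2 by lia, show 3 * (r + 2) - 1 = 3 * r + 5 by lia]
    nlinarith

end SimpleGraph

/-- Let `r ≥ 2`. If `G` is an `n`-vertex `K_{r+1}`-free simple graph with
`(3r-2)·δ(G) + Δ(G) > (3r-4)·n`, then `G` is `r`-partite. -/
theorem stmt_4 {V : Type*} [Fintype V] (r : ℕ) (hr : 2 ≤ r)
    (G : SimpleGraph V) [DecidableRel G.Adj]
    (hfree : G.CliqueFree (r + 1))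
    (hdeg : (3 * r - 4) * Fintype.card V < (3 * r - 2) * G.minDegree + G.maxDegree) :
    G.Colorable r := by
  classical
  obtain ⟨r, rfl⟩ : ∃ m, r = m + 1 := ⟨r - 1, by lia⟩
  obtain ⟨H, hle, hmax⟩ :=
    Finite.exists_le_maximal (p := fun H : SimpleGraph V ↦ H.CliqueFree (r + 2)) hfree
  refine SimpleGraph.Colorable.mono_left hle ?_
  cases isEmpty_or_nonempty V
  · exact SimpleGraph.Colorable.of_isEmpty _
  obtain ⟨u, hu⟩ := H.exists_maximal_degree_vertex
  have hδ := SimpleGraph.minDegree_le_minDegree hle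
  have hΔ := SimpleGraph.maxDegree_mono hle
  have hδu := H.minDegree_le_degree u
  rw [hu] at hΔ
  have hdegH : 3 * r * Fintype.card V <
      (3 * r + 1) * H.minDegree + H.degree u + Fintype.card V := by
    obtain ⟨q, rfl⟩ : ∃ q, r = q + 1 := ⟨r - 1, by lia⟩
    rw [show 3 * (q + 1 + 1) - 4 = 3 * q + 2 by lia,
      show 3 * (q + 1 + 1) - 2 = 3 * q + 4 by lia] at hdeg
    have := Nat.mul_le_mul_left (3 * q + 4) hδ
    linarith
  have hu0 : 0 < H.degree u := by
    by_contra h0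
    have : H.degree u = 0 := by lia
    have h1 : G.maxDegree = 0 := by lia
    have h2 : G.minDegree = 0 := by lia
    simp [h1, h2] at hdeg
  refine (SimpleGraph.colorable_induce_neighborSet hmax.1 hu0 hdegH hδu).of_induce_neighborSet ?_
  intro a b ha hb hab
  exact hdegH.not_ge
    (SimpleGraph.IsPathGraph3Compl.minDegree_mul_add_degree_le ⟨hab, ha, hb⟩ hmax)
end

section
/- Suppose G is an n-vertex triangle-free (K_3-free) simple graph with 4·δ(G) + Δ(G) > 2n (equivalently, δ(G) > n/2 − Δ(G)/4). Then G is bipartite. -/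
namespace SimpleGraph

variable {V : Type*} [Fintype V] {G : SimpleGraph V} [DecidableRel G.Adj]

/-- No vertex of a triangle-free graph is adjacent to both ends of an edge. -/
theorem CliqueFree.not_adj_of_adj_of_adj {V : Type*} {G : SimpleGraph V} (h : G.CliqueFree 3)
    {a b c : V} (hab : G.Adj a b) (hac : G.Adj a c) : ¬ G.Adj b c := by
  classical
  exact fun hbc => h {a, b, c} (is3Clique_triple_iff.mpr ⟨hab, hac, hbc⟩)

theorem degree_eq_sum_ite_adj (v : V) : G.degree v = ∑ z, if G.Adj v z then 1 else 0 := by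
  rw [← card_neighborFinset_eq_degree, neighborFinset_eq_filter, Finset.card_filter]

/-- In a triangle-free graph the degrees along a closed walk of length five sum to at most twice
the number of vertices. -/
theorem CliqueFree.sum_degree_five_cycle_le (h : G.CliqueFree 3) {a b c d e : V}
    (hab : G.Adj a b) (hbc : G.Adj b c) (hcd : G.Adj c d) (hde : G.Adj d e) (hea : G.Adj e a) :
    G.degree a + G.degree b + G.degree c + G.degree d + G.degree e ≤ 2 * Fintype.card V := by
  simp only [degree_eq_sum_ite_adj, ← Finset.sum_add_distrib]
  calc _ ≤ ∑ _z : V, 2 := Finset.sum_le_sum fun z _ => ?_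
    _ = _ := by simp [mul_comm]
  have h₁ := h.not_adj_of_adj_of_adj (c := z) hab
  have h₂ := h.not_adj_of_adj_of_adj (c := z) hbc
  have h₃ := h.not_adj_of_adj_of_adj (c := z) hcd
  have h₄ := h.not_adj_of_adj_of_adj (c := z) hde
  have h₅ := h.not_adj_of_adj_of_adj (c := z) hea
  split_ifs <;> first | omega | tauto

/-- Three vertices without pairwise common neighbours have degree sum at most the number of
vertices. -/
theorem degree_add_degree_add_degree_le {a b c : V}
    (hab : ∀ z, G.Adj a z → ¬ G.Adj b z) (hac : ∀ z, G.Adj a z → ¬ G.Adj c z)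
    (hbc : ∀ z, G.Adj b z → ¬ G.Adj c z) :
    G.degree a + G.degree b + G.degree c ≤ Fintype.card V := by
  simp only [degree_eq_sum_ite_adj, ← Finset.sum_add_distrib]
  calc _ ≤ ∑ _z : V, 1 := Finset.sum_le_sum fun z _ => ?_
    _ = _ := by simp
  have h₁ := hab z
  have h₂ := hac z
  have h₃ := hbc z
  split_ifs <;> first | omega | tauto

end SimpleGraph

/-- If `G` is an `n`-vertex triangle-free simple graph with `4·δ(G) + Δ(G) > 2n`,
then `G` is bipartite. -/
theorem stmt_10 {V : Type*} [Fintype V]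
    (G : SimpleGraph V) [DecidableRel G.Adj]
    (hfree : G.CliqueFree 3)
    (hdeg : 2 * Fintype.card V < 4 * G.minDegree + G.maxDegree) :
    G.Colorable 2 := by
  classical
  cases isEmpty_or_nonempty V
  · exact .of_isEmpty 2
  obtain ⟨v, hv⟩ := G.exists_maximal_degree_vertex
  -- The vertices sharing a neighbour with `v` form one of the two colour classes.
  let C : G.Coloring Prop := SimpleGraph.Coloring.mk (fun x => ∃ u, G.Adj v u ∧ G.Adj u x) ?_
  · simpa using C.colorable
  intro x y hxy heq
  have hx := G.minDegree_le_degree x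
  have hy := G.minDegree_le_degree y
  by_cases hux : ∃ u, G.Adj v u ∧ G.Adj u x
  · obtain ⟨w, hvw, hwy⟩ := heq.mp hux
    obtain ⟨u, hvu, hux⟩ := hux
    have hu := G.minDegree_le_degree u
    have hw := G.minDegree_le_degree w
    have := hfree.sum_degree_five_cycle_le hvu hux hxy hwy.symm hvw.symm
    omega
  · have huy := mt heq.mpr hux
    have := SimpleGraph.degree_add_degree_add_degree_le (G := G) (a := v) (b := x) (c := y)
      (fun z hvz hxz => hux ⟨z, hvz, hxz.symm⟩) (fun z hvz hyz => huy ⟨z, hvz, hyz.symm⟩)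
      (fun z hxz hyz => hfree.not_adj_of_adj_of_adj hxy hxz hyz)
    omega
end

section
/- Let k ≥ 2 and m ≥ k+1 be integers, and let G be an n-vertex C_{≤2k+1}-free simple graph whose shortest odd cycle has length 2m+1. If some cycle of length 2m+1 in G contains a vertex of degree Δ(G), then Δ(G) + 2m·δ(G) ≤ 2n; in particular, δ(G) ≤ n/(k+1) − Δ(G)/(2k+2). -/
namespace SimpleGraph

variable {V : Type*} {G : SimpleGraph V}

/-- The segment of a walk between two of its positions. -/
theorem Walk.exists_length_eq_sub {u v : V} (p : G.Walk u v) {i j : ℕ} (hij : i ≤ j)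
    (hj : j ≤ p.length) : ∃ q : G.Walk (p.getVert i) (p.getVert j), q.length = j - i := by
  refine ⟨((p.drop i).take (j - i)).copy rfl ?_, ?_⟩
  · rw [Walk.drop_getVert, Nat.add_sub_cancel' hij]
  · simp only [Walk.length_copy, Walk.take_length, Walk.drop_length]
    omega

/-- A closed walk of odd length gives rise to an odd cycle that is no longer. -/
theorem Walk.exists_isCycle_odd_length_le {u : V} (c : G.Walk u u) (hc : Odd c.length) :
    ∃ (x : V) (d : G.Walk x x), d.IsCycle ∧ Odd d.length ∧ d.length ≤ c.length := by
  induction hN : c.length using Nat.strong_induction_on generalizing u c with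
  | _ N ih =>
  cases c with
  | nil => simp at hc
  | @cons _ w _ h p =>
  rw [Walk.length_cons] at hc hN
  by_cases hp : p.IsPath
  · refine ⟨u, .cons h p, (Walk.cons_isCycle_iff p h).2 ⟨hp, fun hmem ↦ ?_⟩, hc, hN.le⟩
    have h1 := hp.length_eq_one_of_mem_edges (Sym2.eq_swap ▸ hmem)
    rw [h1] at hc
    exact absurd hc (by decide)
  · obtain ⟨i, j, hij, hj, hv⟩ : ∃ i j, i < j ∧ j ≤ p.length ∧ p.getVert i = p.getVert j := by
      rw [← Walk.IsPath.getVert_injOn_iff] at hp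
      simp only [Set.InjOn, Set.mem_ofPred_eq, not_forall] at hp
      obtain ⟨a, ha, b, hb, hab, hne⟩ := hp
      rcases lt_or_gt_of_ne hne with h' | h'
      · exact ⟨a, b, h', hb, hab⟩
      · exact ⟨b, a, h', ha, hab.symm⟩
    obtain ⟨q, hq⟩ := p.exists_length_eq_sub hij.le hj
    let r : G.Walk u u := .cons h ((p.take i).append ((p.drop j).copy hv.symm rfl))
    have hr : r.length = i + (p.length - j) + 1 := by
      simp only [r, Walk.length_cons, Walk.length_append, Walk.length_copy, Walk.take_length,
        Walk.drop_length]
      omega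
    rcases Nat.even_or_odd (j - i) with he | ho
    · have hro : Odd r.length := by
        rw [hr]
        grind
      obtain ⟨x, d, h1, h2, h3⟩ := ih r.length (by omega) r hro rfl
      exact ⟨x, d, h1, h2, by omega⟩
    · obtain ⟨x, d, h1, h2, h3⟩ := ih (j - i) (by omega) (q.copy rfl hv.symm)
        (by rwa [Walk.length_copy, hq]) (by rw [Walk.length_copy, hq])
      exact ⟨x, d, h1, h2, by omega⟩

/-- Two neighbours of a vertex on a closed walk of minimum odd length are at cyclic distance
two. -/
theorem Walk.sub_eq_two_or_of_adj_getVert {m : ℕ}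
    (hgirth : ∀ (x : V) (c : G.Walk x x), c.IsCycle → Odd c.length → 2 * m + 1 ≤ c.length)
    {x : V} (c : G.Walk x x) (hc : c.length = 2 * m + 1) {u : V} {i j : ℕ} (hij : i < j)
    (hj : j < 2 * m + 1) (hi : G.Adj u (c.getVert i)) (hj' : G.Adj u (c.getVert j)) :
    j = i + 2 ∨ j + 2 = i + (2 * m + 1) := by
  have closed {y : V} (d : G.Walk y y) (hd : Odd d.length) : 2 * m + 1 ≤ d.length := by
    obtain ⟨z, e, h1, h2, h3⟩ := d.exists_isCycle_odd_length_le hd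
    exact (hgirth z e h1 h2).trans h3
  rcases Nat.even_or_odd (j - i) with he | ho
  · have hlen : (Walk.cons hj' (((c.drop j).append (c.take i)).concat hi.symm)).length
        = 2 * m + 1 - (j - i) + 2 := by
      simp only [Walk.length_cons, Walk.length_concat, Walk.length_append, Walk.take_length,
        Walk.drop_length]
      omega
    have h := closed _ (by rw [hlen]; grind)
    rw [hlen] at h
    grind
  · obtain ⟨q, hq⟩ := c.exists_length_eq_sub hij.le (by omega)
    have hlen : (Walk.cons hi (q.concat hj'.symm)).length = j - i + 2 := by
      simp only [Walk.length_cons, Walk.length_concat, hq]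
    have h := closed _ (by rw [hlen]; grind)
    rw [hlen] at h
    grind

/-- A vertex is adjacent to at most two positions of a closed walk of minimum odd length at
least seven. -/
theorem Walk.card_filter_adj_getVert_le_two [DecidableRel G.Adj] {m : ℕ} (hm : 3 ≤ m)
    (hgirth : ∀ (x : V) (c : G.Walk x x), c.IsCycle → Odd c.length → 2 * m + 1 ≤ c.length)
    {x : V} (c : G.Walk x x) (hc : c.length = 2 * m + 1) (u : V) :
    ((Finset.range (2 * m + 1)).filter fun i ↦ G.Adj u (c.getVert i)).card ≤ 2 := by
  by_contra! hlt
  obtain ⟨a, b, d, ha, hb, hd, hab, had, hbd⟩ := Finset.two_lt_card_iff.1 hlt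
  simp only [Finset.mem_filter, Finset.mem_range] at ha hb hd
  have key (i j : ℕ) (hi : i < 2 * m + 1 ∧ G.Adj u (c.getVert i))
      (hj : j < 2 * m + 1 ∧ G.Adj u (c.getVert j)) (hij : i < j) :=
    c.sub_eq_two_or_of_adj_getVert hgirth hc hij hj.1 hi.2 hj.2
  have := key a b ha hb
  have := key b a hb ha
  have := key a d ha hd
  have := key d a hd ha
  have := key b d hb hd
  have := key d b hd hb
  omega

/-- The degrees along a closed walk of minimum odd length at least seven sum to at most twice
the number of vertices. -/
theorem Walk.sum_degree_getVert_le [Fintype V] [DecidableRel G.Adj] {m : ℕ} (hm : 3 ≤ m)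
    (hgirth : ∀ (x : V) (c : G.Walk x x), c.IsCycle → Odd c.length → 2 * m + 1 ≤ c.length)
    {x : V} (c : G.Walk x x) (hc : c.length = 2 * m + 1) :
    ∑ i ∈ Finset.range (2 * m + 1), G.degree (c.getVert i) ≤ 2 * Fintype.card V := by
  calc ∑ i ∈ Finset.range (2 * m + 1), G.degree (c.getVert i)
      = ∑ i ∈ Finset.range (2 * m + 1),
          (Finset.univ.filter fun u ↦ G.Adj u (c.getVert i)).card := by
        refine Finset.sum_congr rfl fun i _ ↦ ?_
        rw [← G.card_neighborFinset_eq_degree]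
        congr 1
        ext u
        simp [G.adj_comm]
    _ = ∑ u : V, ((Finset.range (2 * m + 1)).filter fun i ↦ G.Adj u (c.getVert i)).card :=
        (Finset.sum_card_bipartiteAbove_eq_sum_card_bipartiteBelow
          (fun u i ↦ G.Adj u (c.getVert i))).symm
    _ ≤ ∑ _u : V, 2 :=
        Finset.sum_le_sum fun u _ ↦ c.card_filter_adj_getVert_le_two hm hgirth hc u
    _ = 2 * Fintype.card V := by simp [mul_comm]

end SimpleGraph


/-- Let `k ≥ 2` and `m ≥ k+1`, and let `G` be an `n`-vertex simple graph with no odd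
cycle of length at most `2k+1`, whose shortest odd cycle has length `2m+1`. If some
cycle of length `2m+1` in `G` contains a vertex of degree `Δ(G)`, then
`Δ(G) + 2m·δ(G) ≤ 2n`; in particular, `δ(G) ≤ n/(k+1) − Δ(G)/(2k+2)`. -/
theorem stmt_14 {V : Type*} [Fintype V] (k m : ℕ) (hk : 2 ≤ k) (hm : k + 1 ≤ m)
    (G : SimpleGraph V) [DecidableRel G.Adj]
    (hfree : ∀ (x : V) (c : G.Walk x x), c.IsCycle → Odd c.length → 2 * k + 1 < c.length)
    (hgirth : ∀ (x : V) (c : G.Walk x x), c.IsCycle → Odd c.length → 2 * m + 1 ≤ c.length)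
    (hcyc : ∃ (x : V) (c : G.Walk x x), c.IsCycle ∧ c.length = 2 * m + 1 ∧
      ∃ y ∈ c.support, G.degree y = G.maxDegree) :
    G.maxDegree + 2 * m * G.minDegree ≤ 2 * Fintype.card V ∧
      (G.minDegree : ℝ) ≤
        (Fintype.card V : ℝ) / ((k : ℝ) + 1) - (G.maxDegree : ℝ) / (2 * (k : ℝ) + 2) := by
  have hmain : G.maxDegree + 2 * m * G.minDegree ≤ 2 * Fintype.card V := by
    obtain ⟨x, c, -, hlen, y, hy, hdeg⟩ := hcyc
    obtain ⟨i, hi, hdi⟩ : ∃ i ∈ Finset.range (2 * m + 1),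
        G.degree (c.getVert i) = G.maxDegree := by
      obtain ⟨i, rfl, hi⟩ := SimpleGraph.Walk.mem_support_iff_exists_getVert.1 hy
      rcases hi.lt_or_eq with hlt | rfl
      · exact ⟨i, Finset.mem_range.2 (hlen ▸ hlt), hdeg⟩
      · exact ⟨0, by simp, by rwa [c.getVert_zero, ← c.getVert_length]⟩
    refine le_trans ?_ (c.sum_degree_getVert_le (by omega) hgirth hlen)
    rw [← Finset.add_sum_erase _ _ hi, hdi]
    gcongr
    have hcard : ((Finset.range (2 * m + 1)).erase i).card = 2 * m := by
      simp [Finset.card_erase_of_mem hi]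
    have hsum := Finset.card_nsmul_le_sum ((Finset.range (2 * m + 1)).erase i)
      (fun j ↦ G.degree (c.getVert j)) G.minDegree fun j _ ↦ G.minDegree_le_degree _
    rwa [hcard, smul_eq_mul] at hsum
  refine ⟨hmain, ?_⟩
  have hR : (G.maxDegree : ℝ) + 2 * (k + 1) * G.minDegree ≤ 2 * Fintype.card V := by
    exact_mod_cast le_trans (by gcongr) hmain
  have hk1 : (0 : ℝ) < k + 1 := by positivity
  rw [show (2 : ℝ) * k + 2 = 2 * (k + 1) by ring, ← mul_div_mul_left _ _ (two_ne_zero' ℝ),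
    ← sub_div, le_div_iff₀ (by positivity)]
  linarith
end
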